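/- Let r be a rational number with 0 < r ≤ 1. If r ≤ 1/2, then there exists a Z-retraction of [0,1] onto [0,r] having exactly two Z-homeomorphism domains, and every Z-retraction of [0,1] onto [0,r] has at most two Z-homeomorphism domains (namely among [0,r] and [1−r,1]). If r > 1/2, then every Z-retraction of [0,1] onto [0,r] has exactly one Z-homeomorphism domain, namely [0,r]. In particular, the index of the MV-algebra McN([0,r]) equals 2 if r ≤ 1/2 and equals 1 if r > 1/2. -/

import Mathlib

open Set MeasureTheory

/-- The unit cube `[0,1]^n` in `ℝ^n`. -/
def cubeSet (n : ℕ) : Set (Fin n → ℝ) := Set.Icc 0 1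

/-- A point all of whose coordinates are rational. -/
def IsRationalPoint {n : ℕ} (v : Fin n → ℝ) : Prop := ∀ i, ∃ q : ℚ, v i = (q : ℝ)

/-- A rational polyhedron: a finite union of convex hulls of finite sets of rational points. -/
def IsRationalPolyhedron {n : ℕ} (P : Set (Fin n → ℝ)) : Prop :=
  ∃ S : Finset (Finset (Fin n → ℝ)),
    (∀ F ∈ S, ∀ v ∈ F, IsRationalPoint v) ∧
    P = ⋃ F ∈ S, convexHull ℝ (F : Set (Fin n → ℝ))

/-- An affine map `x ↦ Mx + b` with integer matrix `M` and integer vector `b`. -/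
def IsIntAffine {n m : ℕ} (g : (Fin n → ℝ) → (Fin m → ℝ)) : Prop :=
  ∃ (M : Fin m → Fin n → ℤ) (b : Fin m → ℤ),
    ∀ x i, g x i = (∑ j, (M i j : ℝ) * x j) + (b i : ℝ)

/-- A Z-map on `P`: continuous on `P`, with finitely many integer affine pieces. -/
def IsZMapOn {n m : ℕ} (P : Set (Fin n → ℝ)) (f : (Fin n → ℝ) → (Fin m → ℝ)) : Prop :=
  ContinuousOn f P ∧
  ∃ (k : ℕ) (g : Fin k → (Fin n → ℝ) → (Fin m → ℝ)),
    (∀ i, IsIntAffine (g i)) ∧ ∀ x ∈ P, ∃ i, f x = g i x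

/-- `f` restricted to `P` is a Z-homeomorphism of `P` onto `Q`. -/
def IsZHomeoOnto {n m : ℕ} (P : Set (Fin n → ℝ)) (Q : Set (Fin m → ℝ))
    (f : (Fin n → ℝ) → (Fin m → ℝ)) : Prop :=
  IsZMapOn P f ∧ f '' P = Q ∧ Set.InjOn f P ∧
  ∃ g : (Fin m → ℝ) → (Fin n → ℝ),
    IsZMapOn Q g ∧ (∀ x ∈ P, g (f x) = x) ∧ (∀ y ∈ Q, f (g y) = y)

/-- A Z-retraction of the cube `[0,1]^n`. -/
def IsZRetraction {n : ℕ} (σ : (Fin n → ℝ) → (Fin n → ℝ)) : Prop :=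
  IsZMapOn (cubeSet n) σ ∧ Set.MapsTo σ (cubeSet n) (cubeSet n) ∧
  ∀ x ∈ cubeSet n, σ (σ x) = σ x

/-- The range `R_σ = σ([0,1]^n)` of a Z-retraction. -/
def zRange {n : ℕ} (σ : (Fin n → ℝ) → (Fin n → ℝ)) : Set (Fin n → ℝ) := σ '' cubeSet n

/-- A Z-homeomorphism domain for `σ`: a rational polyhedron `Q ⊆ [0,1]^n` such that
`σ` restricted to `Q` is a Z-homeomorphism of `Q` onto `R_σ`. -/
def IsZHomeoDomain {n : ℕ} (σ : (Fin n → ℝ) → (Fin n → ℝ)) (Q : Set (Fin n → ℝ)) : Prop :=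
  IsRationalPolyhedron Q ∧ Q ⊆ cubeSet n ∧ IsZHomeoOnto Q (zRange σ) σ

/-- A (Kuratowski) closed domain: `D` equals the closure of its interior. -/
def IsClosedDomain {n : ℕ} (D : Set (Fin n → ℝ)) : Prop :=
  closure (interior D) = D

/-- A scalar integer affine map. -/
def IsIntAffine1 {n : ℕ} (g : (Fin n → ℝ) → ℝ) : Prop :=
  ∃ (m : Fin n → ℤ) (b : ℤ), ∀ x, g x = (∑ j, (m j : ℝ) * x j) + (b : ℝ)

/-- A scalar Z-map on `P`. -/
def IsZMapOn1 {n : ℕ} (P : Set (Fin n → ℝ)) (f : (Fin n → ℝ) → ℝ) : Prop :=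
  ContinuousOn f P ∧
  ∃ (k : ℕ) (g : Fin k → (Fin n → ℝ) → ℝ),
    (∀ i, IsIntAffine1 (g i)) ∧ ∀ x ∈ P, ∃ i, f x = g i x

/-- The free MV-algebra `McN([0,1]^n)`, viewed as a set of functions on the cube. -/
def McN (n : ℕ) : Set (↥(cubeSet n) → ℝ) :=
  { f | (∀ x, f x ∈ Set.Icc (0:ℝ) 1) ∧
    ∃ g : (Fin n → ℝ) → ℝ, IsZMapOn1 (cubeSet n) g ∧ ∀ x : ↥(cubeSet n), f x = g x.1 }

/-- Pointwise MV-sum `f ⊕ g = min(f + g, 1)`. -/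
def mvAdd {X : Type*} (f g : X → ℝ) : X → ℝ := fun x => min (f x + g x) 1

/-- Pointwise MV-negation `¬f = 1 - f`. -/
def mvNeg {X : Type*} (f : X → ℝ) : X → ℝ := fun x => 1 - f x

/-- The retract `A_σ = {g ∘ σ : g ∈ McN([0,1]^n)}` associated with a Z-retraction `σ`. -/
def retAlg {n : ℕ} (σ : (Fin n → ℝ) → (Fin n → ℝ)) : Set (↥(cubeSet n) → ℝ) :=
  { f | ∃ g ∈ McN n, ∀ (x : ↥(cubeSet n)) (h : σ x.1 ∈ cubeSet n), f x = g ⟨σ x.1, h⟩ }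

/-- `ε` is a retraction of `McN([0,1]^n)` onto `A`. -/
def IsMcNRetraction {n : ℕ} (ε : ↥(McN n) → ↥(McN n)) (A : Set (↥(cubeSet n) → ℝ)) : Prop :=
  (∀ (f g : ↥(McN n)) (h : mvAdd f.1 g.1 ∈ McN n),
      (ε ⟨mvAdd f.1 g.1, h⟩).1 = mvAdd (ε f).1 (ε g).1) ∧
  (∀ (f : ↥(McN n)) (h : mvNeg f.1 ∈ McN n),
      (ε ⟨mvNeg f.1, h⟩).1 = mvNeg (ε f).1) ∧
  (∀ f, ε (ε f) = ε f) ∧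
  Subtype.val '' Set.range ε = A

/-- An MV-isomorphism between two sets of `[0,1]`-valued functions. -/
def IsMVIsoFun {X Y : Type*} (A : Set (X → ℝ)) (B : Set (Y → ℝ)) (h : ↥A → ↥B) : Prop :=
  Function.Bijective h ∧
  (∀ (f g : ↥A) (hm : mvAdd f.1 g.1 ∈ A),
      (h ⟨mvAdd f.1 g.1, hm⟩).1 = mvAdd (h f).1 (h g).1) ∧
  (∀ (f : ↥A) (hm : mvNeg f.1 ∈ A),
      (h ⟨mvNeg f.1, hm⟩).1 = mvNeg (h f).1)

/-- The segment `[a,b]` viewed as a subset of `ℝ¹`. -/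
def seg (a b : ℝ) : Set (Fin 1 → ℝ) := {v | a ≤ v 0 ∧ v 0 ≤ b}

/-- The MV-algebra `McN([0,r])` of restrictions to `[0,r]` of Z-maps `[0,1] → [0,1]`. -/
def McNSeg (r : ℝ) : Set (↥(seg 0 r) → ℝ) :=
  { f | ∃ g : (Fin 1 → ℝ) → ℝ, IsZMapOn1 (cubeSet 1) g ∧
      (∀ x ∈ cubeSet 1, g x ∈ Set.Icc (0:ℝ) 1) ∧ ∀ x : ↥(seg 0 r), f x = g x.1 }

/-- A continuous real function on `S` with finitely many integer affine pieces. -/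
def IsZFun (S : Set ℝ) (f : ℝ → ℝ) : Prop :=
  ContinuousOn f S ∧
    ∃ T : Set (ℤ × ℤ), T.Finite ∧ ∀ x ∈ S, ∃ p ∈ T, f x = (p.1 : ℝ) * x + (p.2 : ℝ)

namespace IsZFun

variable {S S' : Set ℝ} {f g : ℝ → ℝ}

theorem mono (hf : IsZFun S f) (h : S' ⊆ S) : IsZFun S' f := by
  obtain ⟨hc, T, hT, hfT⟩ := hf
  exact ⟨hc.mono h, T, hT, fun x hx => hfT x (h hx)⟩

theorem affine (S : Set ℝ) (m b : ℤ) : IsZFun S (fun x => (m : ℝ) * x + (b : ℝ)) :=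
  ⟨by fun_prop, {(m, b)}, Set.finite_singleton _, fun _ _ => ⟨(m, b), rfl, rfl⟩⟩

theorem id (S : Set ℝ) : IsZFun S (fun x => x) := by
  simpa using affine S 1 0

theorem one (S : Set ℝ) : IsZFun S (fun _ => 1) := by
  simpa using affine S 0 1

theorem zero (S : Set ℝ) : IsZFun S (fun _ => 0) := by
  simpa using affine S 0 0

theorem add (hf : IsZFun S f) (hg : IsZFun S g) : IsZFun S (fun x => f x + g x) := by
  obtain ⟨hfc, T, hT, hfT⟩ := hf
  obtain ⟨hgc, T', hT', hgT⟩ := hg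
  refine ⟨hfc.add hgc, Set.image2 (fun p q => p + q) T T', hT.image2 _ hT', fun x hx => ?_⟩
  obtain ⟨p, hp, hpx⟩ := hfT x hx
  obtain ⟨q, hq, hqx⟩ := hgT x hx
  refine ⟨p + q, Set.mem_image2_of_mem hp hq, ?_⟩
  simp only [hpx, hqx, Prod.fst_add, Prod.snd_add]
  push_cast
  ring

theorem comp (hf : IsZFun S' f) (hg : IsZFun S g) (h : MapsTo g S S') :
    IsZFun S (fun x => f (g x)) := by
  obtain ⟨hfc, T, hT, hfT⟩ := hf
  obtain ⟨hgc, T', hT', hgT⟩ := hg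
  refine ⟨hfc.comp hgc h,
    Set.image2 (fun p q => (p.1 * q.1, p.1 * q.2 + p.2)) T T', hT.image2 _ hT', fun x hx => ?_⟩
  obtain ⟨p, hp, hpx⟩ := hfT (g x) (h hx)
  obtain ⟨q, hq, hqx⟩ := hgT x hx
  refine ⟨_, Set.mem_image2_of_mem hp hq, ?_⟩
  dsimp only
  rw [hpx, hqx]
  push_cast
  ring

theorem one_sub (hf : IsZFun S f) : IsZFun S (fun x => 1 - f x) := by
  have h := (affine Set.univ (-1) 1).comp hf (mapsTo_univ _ _)
  refine (funext fun x => ?_ : (fun x => 1 - f x) = _) ▸ h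
  push_cast
  ring

theorem inf (hf : IsZFun S f) (hg : IsZFun S g) : IsZFun S (fun x => min (f x) (g x)) := by
  obtain ⟨hfc, T, hT, hfT⟩ := hf
  obtain ⟨hgc, T', hT', hgT⟩ := hg
  refine ⟨ContinuousOn.inf hfc hgc, T ∪ T', hT.union hT', fun x hx => ?_⟩
  rcases min_choice (f x) (g x) with h | h
  · obtain ⟨p, hp, hpx⟩ := hfT x hx
    exact ⟨p, Or.inl hp, h.trans hpx⟩
  · obtain ⟨p, hp, hpx⟩ := hgT x hx
    exact ⟨p, Or.inr hp, h.trans hpx⟩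

theorem sup (hf : IsZFun S f) (hg : IsZFun S g) : IsZFun S (fun x => max (f x) (g x)) := by
  have h := (hf.one_sub.inf hg.one_sub).one_sub
  refine (funext fun x => ?_ : (fun x => max (f x) (g x)) = _) ▸ h
  rcases le_total (f x) (g x) with h | h
  · rw [max_eq_right h, min_eq_right (by linarith)]; ring
  · rw [max_eq_left h, min_eq_left (by linarith)]; ring

theorem isZMapOn1 (hf : IsZFun S f) :
    IsZMapOn1 {v : Fin 1 → ℝ | v 0 ∈ S} (fun v => f (v 0)) := by
  obtain ⟨hfc, T, hT, hfT⟩ := hf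
  refine ⟨hfc.comp (continuous_apply 0).continuousOn (fun v hv => hv), ?_⟩
  have := hT.fintype
  let e := (Fintype.equivFin T).symm
  refine ⟨Fintype.card T, fun i v => ((e i).1.1 : ℝ) * v 0 + ((e i).1.2 : ℝ),
    fun i => ⟨fun _ => (e i).1.1, (e i).1.2, fun x => by simp⟩, fun v hv => ?_⟩
  obtain ⟨p, hp, hpx⟩ := hfT (v 0) hv
  exact ⟨e.symm ⟨p, hp⟩, by simp [hpx]⟩

theorem isZMapOn (hf : IsZFun S f) :
    IsZMapOn {v : Fin 1 → ℝ | v 0 ∈ S} (fun v (_ : Fin 1) => f (v 0)) := by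
  obtain ⟨hc, k, g, hg, hfg⟩ := hf.isZMapOn1
  refine ⟨continuousOn_pi.2 fun _ => hc, k, fun i v _ => g i v, fun i => ?_, fun v hv => ?_⟩
  · obtain ⟨m, b, h⟩ := hg i
    exact ⟨fun _ => m, fun _ => b, fun x _ => h x⟩
  · obtain ⟨i, hi⟩ := hfg v hv
    exact ⟨i, funext fun _ => hi⟩

end IsZFun

theorem mem_cubeSet_one {v : Fin 1 → ℝ} : v ∈ cubeSet 1 ↔ v 0 ∈ Icc (0 : ℝ) 1 := by
  simp [cubeSet, Pi.le_def]

theorem cubeSet_one_eq : cubeSet 1 = {v : Fin 1 → ℝ | v 0 ∈ Icc (0 : ℝ) 1} :=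
  Set.ext fun _ => mem_cubeSet_one

theorem const_apply_zero (v : Fin 1 → ℝ) : (fun _ => v 0) = v :=
  funext fun i => by rw [Subsingleton.elim i 0]

theorem seg_subset_cubeSet {a b : ℝ} (ha : 0 ≤ a) (hb : b ≤ 1) : seg a b ⊆ cubeSet 1 :=
  fun _ hv => mem_cubeSet_one.2 ⟨ha.trans hv.1, hv.2.trans hb⟩

theorem IsZMapOn1.isZFun {g : (Fin 1 → ℝ) → ℝ} (hg : IsZMapOn1 (cubeSet 1) g) :
    IsZFun (Icc 0 1) (fun t => g (fun _ => t)) := by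
  obtain ⟨hc, k, a, ha, hga⟩ := hg
  choose m b h using ha
  refine ⟨hc.comp (by fun_prop) (fun t ht => mem_cubeSet_one.2 ht),
    Set.range fun i => (m i 0, b i), Set.finite_range _, fun t ht => ?_⟩
  obtain ⟨i, hi⟩ := hga (fun _ => t) (mem_cubeSet_one.2 ht)
  exact ⟨_, ⟨i, rfl⟩, by simp [hi, h]⟩

theorem IsZMapOn.exists_int {P : Set (Fin 1 → ℝ)} {f : (Fin 1 → ℝ) → (Fin 1 → ℝ)}
    (hf : IsZMapOn P f) {v : Fin 1 → ℝ} (hv : v ∈ P) :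
    ∃ m b : ℤ, f v 0 = (m : ℝ) * v 0 + (b : ℝ) := by
  obtain ⟨-, k, a, ha, hfa⟩ := hf
  obtain ⟨i, hi⟩ := hfa v hv
  obtain ⟨M, b, h⟩ := ha i
  exact ⟨M 0 0, b 0, by rw [hi, h]; simp⟩

theorem IsZMapOn.mono {n m : ℕ} {P Q : Set (Fin n → ℝ)} {f : (Fin n → ℝ) → (Fin m → ℝ)}
    (hf : IsZMapOn P f) (h : Q ⊆ P) : IsZMapOn Q f := by
  obtain ⟨hc, k, a, ha, hfa⟩ := hf
  exact ⟨hc.mono h, k, a, ha, fun x hx => hfa x (h hx)⟩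

theorem mem_McN_one {f : ↥(cubeSet 1) → ℝ} :
    f ∈ McN 1 ↔ ∃ F : ℝ → ℝ, IsZFun (Icc 0 1) F ∧ MapsTo F (Icc 0 1) (Icc 0 1) ∧
      ∀ x : ↥(cubeSet 1), f x = F (x.1 0) := by
  constructor
  · rintro ⟨hf, g, hg, hfg⟩
    refine ⟨fun t => g (fun _ => t), hg.isZFun, fun t ht => ?_, fun x => ?_⟩
    · have := hf ⟨fun _ => t, mem_cubeSet_one.2 ht⟩
      rwa [hfg] at this
    · simp only [const_apply_zero, hfg]
  · rintro ⟨F, hF, hm, hfF⟩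
    refine ⟨fun x => ?_, fun v => F (v 0), ?_, hfF⟩
    · rw [hfF]
      exact hm (mem_cubeSet_one.1 x.2)
    · rw [cubeSet_one_eq]
      exact hF.isZMapOn1

theorem mem_McNSeg {r : ℝ} {f : ↥(seg 0 r) → ℝ} :
    f ∈ McNSeg r ↔ ∃ F : ℝ → ℝ, IsZFun (Icc 0 1) F ∧ MapsTo F (Icc 0 1) (Icc 0 1) ∧
      ∀ x : ↥(seg 0 r), f x = F (x.1 0) := by
  constructor
  · rintro ⟨g, hg, hf, hfg⟩
    refine ⟨fun t => g (fun _ => t), hg.isZFun,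
      fun t ht => hf _ (mem_cubeSet_one.2 ht), fun x => ?_⟩
    simp only [const_apply_zero, hfg]
  · rintro ⟨F, hF, hm, hfF⟩
    refine ⟨fun v => F (v 0), ?_, fun v hv => hm (mem_cubeSet_one.1 hv), hfF⟩
    rw [cubeSet_one_eq]
    exact hF.isZMapOn1

theorem mvAdd_mem_McN {f g : ↥(cubeSet 1) → ℝ} (hf : f ∈ McN 1) (hg : g ∈ McN 1) :
    mvAdd f g ∈ McN 1 := by
  obtain ⟨F, hF, hFm, hfF⟩ := mem_McN_one.1 hf
  obtain ⟨G, hG, hGm, hgG⟩ := mem_McN_one.1 hg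
  refine mem_McN_one.2 ⟨_, (hF.add hG).inf (IsZFun.one _), fun t ht => ?_, fun x => ?_⟩
  · exact ⟨le_min (add_nonneg (hFm ht).1 (hGm ht).1) zero_le_one, min_le_right _ _⟩
  · simp [mvAdd, hfF, hgG]

theorem mvNeg_mem_McN {f : ↥(cubeSet 1) → ℝ} (hf : f ∈ McN 1) : mvNeg f ∈ McN 1 := by
  obtain ⟨F, hF, hFm, hfF⟩ := mem_McN_one.1 hf
  refine mem_McN_one.2 ⟨_, hF.one_sub, fun t ht => ?_, fun x => ?_⟩
  · exact ⟨sub_nonneg.2 (hFm ht).2, sub_le_self _ (hFm ht).1⟩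
  · simp [mvNeg, hfF]

/-- Truncation to the unit interval. -/
noncomputable def clamp (t : ℝ) : ℝ := max 0 (min t 1)

theorem clamp_mem (t : ℝ) : clamp t ∈ Icc (0 : ℝ) 1 :=
  ⟨le_max_left _ _, max_le zero_le_one (min_le_right _ _)⟩

theorem clamp_of_mem {t : ℝ} (ht : t ∈ Icc (0 : ℝ) 1) : clamp t = t := by
  rw [clamp, min_eq_left ht.2, max_eq_right ht.1]

theorem clamp_of_nonpos {t : ℝ} (ht : t ≤ 0) : clamp t = 0 :=
  max_eq_left ((min_le_left _ _).trans ht)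

theorem clamp_of_one_le {t : ℝ} (ht : 1 ≤ t) : clamp t = 1 := by
  rw [clamp, min_eq_right ht, max_eq_right zero_le_one]

theorem clamp_one_sub (t : ℝ) : clamp (1 - t) = 1 - clamp t := by
  simp only [clamp, max_def, min_def]
  split_ifs <;> linarith

theorem clamp_add {x : ℝ} (hx : x ∈ Icc (0 : ℝ) 1) (t : ℝ) :
    clamp (t + x) = 1 - min ((1 - min (clamp t + x) 1) + (1 - clamp (t + 1))) 1 := by
  obtain ⟨h0, h1⟩ := hx
  simp only [clamp, max_def, min_def]
  split_ifs <;> linarith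

/-- The point of the one-dimensional cube with coordinate `clamp t`. -/
noncomputable def cubePt (t : ℝ) : ↥(cubeSet 1) :=
  ⟨fun _ => clamp t, mem_cubeSet_one.2 (clamp_mem t)⟩

theorem cubePt_apply {t : ℝ} (ht : t ∈ Icc (0 : ℝ) 1) : (cubePt t).1 0 = t :=
  clamp_of_mem ht

theorem cubePt_coord (x : ↥(cubeSet 1)) : cubePt (x.1 0) = x := by
  apply Subtype.ext
  rw [← const_apply_zero x.1]
  exact funext fun _ => clamp_of_mem (mem_cubeSet_one.1 x.2)

/-- The identity function as an element of `McN 1`. -/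
def coordMcN : ↥(McN 1) :=
  ⟨fun x => x.1 0, mem_McN_one.2 ⟨fun t => t, IsZFun.id _, fun _ ht => ht, fun _ => rfl⟩⟩

theorem exists_clamp_hom {φ : ↥(McN 1) → ℝ} (hmem : ∀ f, φ f ∈ Icc (0 : ℝ) 1)
    (hadd : ∀ (f g : ↥(McN 1)) (h : mvAdd f.1 g.1 ∈ McN 1),
      φ ⟨mvAdd f.1 g.1, h⟩ = min (φ f + φ g) 1)
    (hneg : ∀ (f : ↥(McN 1)) (h : mvNeg f.1 ∈ McN 1), φ ⟨mvNeg f.1, h⟩ = 1 - φ f)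
    (f : ↥(McN 1)) (k b : ℤ) :
    ∃ h : (fun x => clamp (k * f.1 x + b)) ∈ McN 1, φ ⟨_, h⟩ = clamp (k * φ f + b) := by
  let R : (↥(cubeSet 1) → ℝ) → ℝ → Prop := fun u t => ∃ h : u ∈ McN 1, φ ⟨u, h⟩ = t
  have radd : ∀ {u v s t}, R u s → R v t → R (mvAdd u v) (min (s + t) 1) := by
    rintro u v s t ⟨hu, rfl⟩ ⟨hv, rfl⟩
    exact ⟨mvAdd_mem_McN hu hv, hadd ⟨u, hu⟩ ⟨v, hv⟩ _⟩
  have rneg : ∀ {u s}, R u s → R (mvNeg u) (1 - s) := by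
    rintro u s ⟨hu, rfl⟩
    exact ⟨mvNeg_mem_McN hu, hneg ⟨u, hu⟩ _⟩
  have rf : R f.1 (φ f) := ⟨f.2, rfl⟩
  have rone : R (fun _ => 1) 1 := by
    have := radd rf (rneg rf)
    have e : mvAdd f.1 (mvNeg f.1) = fun _ => 1 := by funext x; simp [mvAdd, mvNeg]
    rw [e] at this
    simpa using this
  have rzero : R (fun _ => 0) 0 := by
    have := rneg rone
    have e : mvNeg (fun _ : ↥(cubeSet 1) => (1 : ℝ)) = fun _ => 0 := by funext x; simp [mvNeg]
    rw [e] at this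
    simpa using this
  have hnat : ∀ (k : ℕ) (b : ℤ),
      R (fun x => clamp ((k : ℝ) * f.1 x + b)) (clamp ((k : ℝ) * φ f + b)) := by
    intro k
    induction k with
    | zero =>
      intro b
      simp only [Nat.cast_zero, zero_mul, zero_add]
      rcases le_or_gt b 0 with hb | hb
      · rw [clamp_of_nonpos (by exact_mod_cast hb)]
        exact rzero
      · rw [clamp_of_one_le (by exact_mod_cast hb)]
        exact rone
    | succ k ih =>
      intro b
      have key := rneg (radd (rneg (radd (ih b) rf)) (rneg (ih (b + 1))))
      have e1 : ∀ t ∈ Icc (0 : ℝ) 1, clamp (((k + 1 : ℕ) : ℝ) * t + b) =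
          1 - min ((1 - min (clamp ((k : ℝ) * t + b) + t) 1) +
            (1 - clamp ((k : ℝ) * t + ((b + 1 : ℤ) : ℝ)))) 1 := by
        intro t ht
        rw [show ((k + 1 : ℕ) : ℝ) * t + b = ((k : ℝ) * t + b) + t by push_cast; ring,
          clamp_add ht]
        push_cast
        rw [add_assoc]
      rw [e1 _ (hmem f)]
      rw [show (fun x => clamp (((k + 1 : ℕ) : ℝ) * f.1 x + b)) = _ from
        funext fun x => e1 _ (f.2.1 x)]
      exact key
  rcases Int.eq_nat_or_neg k with ⟨n, rfl | rfl⟩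
  · exact_mod_cast hnat n b
  · have key := rneg (hnat n (1 - b))
    have e : ∀ t : ℝ, clamp (((-(n : ℤ) : ℤ) : ℝ) * t + b) =
        1 - clamp ((n : ℝ) * t + ((1 - b : ℤ) : ℝ)) := by
      intro t
      rw [← clamp_one_sub]
      push_cast
      congr 1
      ring
    show R _ _
    rw [e, show (fun x => clamp (((-(n : ℤ) : ℤ) : ℝ) * f.1 x + b)) = _ from
        funext fun x => e (f.1 x)]
    exact key

/-- Every MV-homomorphism of `McN 1` to the unit interval is evaluation at a point. -/
theorem hom_eq_eval {φ : ↥(McN 1) → ℝ} (hmem : ∀ f, φ f ∈ Icc (0 : ℝ) 1)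
    (hadd : ∀ (f g : ↥(McN 1)) (h : mvAdd f.1 g.1 ∈ McN 1),
      φ ⟨mvAdd f.1 g.1, h⟩ = min (φ f + φ g) 1)
    (hneg : ∀ (f : ↥(McN 1)) (h : mvNeg f.1 ∈ McN 1), φ ⟨mvNeg f.1, h⟩ = 1 - φ f)
    (f : ↥(McN 1)) : φ f = f.1 (cubePt (φ coordMcN)) := by
  set c := φ coordMcN with hc
  have hcm : c ∈ Icc (0 : ℝ) 1 := hmem _
  have hle : ∀ f : ↥(McN 1), φ f ≤ f.1 (cubePt c) := by
    intro f
    by_contra! hlt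
    obtain ⟨F, hF, -, hfF⟩ := mem_McN_one.1 f.2
    have hfc : f.1 (cubePt c) = F c := by rw [hfF, cubePt_apply hcm]
    rw [hfc] at hlt
    obtain ⟨k, hk⟩ := exists_nat_gt (2 / (φ f - F c))
    rw [div_lt_iff₀ (by linarith)] at hk
    obtain ⟨hu, hφu⟩ := exists_clamp_hom hmem hadd hneg f k (-(⌊(k : ℝ) * F c⌋ + 1))
    have hfl := Int.lt_floor_add_one ((k : ℝ) * F c)
    have hfl' := Int.floor_le ((k : ℝ) * F c)
    push_cast at hu hφu
    rw [clamp_of_one_le (by linarith)] at hφu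
    obtain ⟨δ, hδ, hnear⟩ : ∃ δ > 0, ∀ t ∈ Icc (0 : ℝ) 1, |t - c| < δ →
        (k : ℝ) * F t < ⌊(k : ℝ) * F c⌋ + 1 := by
      have hcont : ContinuousWithinAt (fun t => (k : ℝ) * F t) (Icc 0 1) c :=
        (hF.1 c hcm).const_mul _
      have hev := hcont.eventually (gt_mem_nhds hfl)
      obtain ⟨δ, hδ, h⟩ := Metric.mem_nhdsWithin_iff.1 hev
      exact ⟨δ, hδ, fun t ht htc => h ⟨by simpa [Real.dist_eq] using htc, ht⟩⟩
    obtain ⟨N, hN⟩ := exists_nat_gt (2 / δ)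
    rw [div_lt_iff₀ hδ] at hN
    have hfN := Int.lt_floor_add_one ((N : ℝ) * c)
    have hfN' := Int.floor_le ((N : ℝ) * c)
    obtain ⟨hv, hφv⟩ := exists_clamp_hom hmem hadd hneg coordMcN N (-(⌊(N : ℝ) * c⌋ + 1))
    obtain ⟨hw, hφw⟩ := exists_clamp_hom hmem hadd hneg coordMcN (-N) ⌊(N : ℝ) * c⌋
    push_cast at hv hφv hw hφw
    rw [← hc, clamp_of_nonpos (by linarith)] at hφv hφw
    have hvw := hadd ⟨_, hv⟩ ⟨_, hw⟩ (mvAdd_mem_McN hv hw)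
    have hnu := hneg ⟨_, hu⟩ (mvNeg_mem_McN hu)
    have hall := hadd ⟨_, mvNeg_mem_McN hu⟩ ⟨_, mvAdd_mem_McN hv hw⟩
      (mvAdd_mem_McN (mvNeg_mem_McN hu) (mvAdd_mem_McN hv hw))
    have hone := hadd f ⟨_, mvNeg_mem_McN f.2⟩ (mvAdd_mem_McN f.2 (mvNeg_mem_McN f.2))
    rw [hneg f] at hone
    rw [hvw, hnu, hφu, hφv, hφw] at hall
    have hEq : mvAdd (mvNeg fun x => clamp ((k : ℝ) * f.1 x + -(⌊(k : ℝ) * F c⌋ + 1)))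
        (mvAdd (fun x => clamp ((N : ℝ) * coordMcN.1 x + -(⌊(N : ℝ) * c⌋ + 1)))
          (fun x => clamp (-(N : ℝ) * coordMcN.1 x + ⌊(N : ℝ) * c⌋))) =
        mvAdd f.1 (mvNeg f.1) := by
      funext x
      have hx := mem_cubeSet_one.1 x.2
      have hR : mvAdd f.1 (mvNeg f.1) x = 1 := by simp [mvAdd, mvNeg]
      rw [hR]
      simp only [mvAdd, mvNeg, hfF]
      have hcx : coordMcN.1 x = x.1 0 := rfl
      rw [hcx]
      refine min_eq_right ?_
      by_cases hd : |x.1 0 - c| < δ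
      · rw [clamp_of_nonpos (by linarith [hnear _ hx hd])]
        have := (clamp_mem ((N : ℝ) * x.1 0 + -(⌊(N : ℝ) * c⌋ + 1))).1
        have := (clamp_mem (-(N : ℝ) * x.1 0 + ⌊(N : ℝ) * c⌋)).1
        have : 0 ≤ min (clamp ((N : ℝ) * x.1 0 + -(⌊(N : ℝ) * c⌋ + 1)) +
          clamp (-(N : ℝ) * x.1 0 + ⌊(N : ℝ) * c⌋)) 1 := le_min (by linarith) zero_le_one
        linarith
      · have h1 := (clamp_mem ((k : ℝ) * F (x.1 0) + -(⌊(k : ℝ) * F c⌋ + 1))).2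
        have hvw1 : 1 ≤ min (clamp ((N : ℝ) * x.1 0 + -(⌊(N : ℝ) * c⌋ + 1)) +
            clamp (-(N : ℝ) * x.1 0 + ⌊(N : ℝ) * c⌋)) 1 := by
          refine le_min ?_ le_rfl
          have hN0 : (0 : ℝ) ≤ N := N.cast_nonneg
          have ha := (clamp_mem ((N : ℝ) * x.1 0 + -(⌊(N : ℝ) * c⌋ + 1))).1
          have hb := (clamp_mem (-(N : ℝ) * x.1 0 + ⌊(N : ℝ) * c⌋)).1
          rcases le_abs.1 (not_lt.1 hd) with h | h
          · have := mul_le_mul_of_nonneg_left h hN0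
            rw [clamp_of_one_le (by nlinarith)]
            linarith
          · have := mul_le_mul_of_nonneg_left h hN0
            rw [add_comm, clamp_of_one_le (by nlinarith)]
            linarith
        linarith
    have hEq' : φ ⟨_, mvAdd_mem_McN (mvNeg_mem_McN hu) (mvAdd_mem_McN hv hw)⟩ =
        φ ⟨_, mvAdd_mem_McN f.2 (mvNeg_mem_McN f.2)⟩ := congrArg φ (Subtype.ext hEq)
    rw [hall, hone] at hEq'
    norm_num at hEq'
  refine le_antisymm (hle f) ?_
  have := hle ⟨_, mvNeg_mem_McN f.2⟩
  rw [hneg f] at this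
  simp only [mvNeg] at this
  linarith

/-- A continuous injection of `[0,r]` into `[0,1]` that is pointwise integer affine, with pointwise
integer affine inverse, is the identity or the reflection `y ↦ 1 - y`. -/
theorem eq_id_or_eq_one_sub {r : ℝ} (hr0 : 0 < r) (hr1 : r ≤ 1) {g : ℝ → ℝ}
    (hc : ContinuousOn g (Icc 0 r)) (hm : MapsTo g (Icc 0 r) (Icc 0 1))
    (hinj : InjOn g (Icc 0 r))
    (hg : ∀ y ∈ Icc 0 r, ∃ m b : ℤ, g y = m * y + b)
    (hf : ∀ y ∈ Icc 0 r, ∃ m b : ℤ, y = m * g y + b) :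
    (∀ y ∈ Icc 0 r, g y = y) ∨ (∀ y ∈ Icc 0 r, g y = 1 - y) := by
  have hirr : ∀ y ∈ Ioo 0 r, Irrational y → g y = y ∨ g y = 1 - y := by
    intro y hy hyi
    have hyI : y ∈ Icc 0 r := Ioo_subset_Icc_self hy
    obtain ⟨m, b, hmb⟩ := hg y hyI
    obtain ⟨m', b', hmb'⟩ := hf y hyI
    have hmm : m' * m = 1 := by
      by_contra hne
      apply hyi
      have hne' : ((1 - m' * m : ℤ) : ℝ) ≠ 0 := by
        rw [Int.cast_ne_zero]
        omega
      refine ⟨((m' * b + b' : ℤ) : ℚ) / ((1 - m' * m : ℤ) : ℚ), ?_⟩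
      rw [Rat.cast_div, Rat.cast_intCast, Rat.cast_intCast, div_eq_iff hne']
      rw [hmb] at hmb'
      push_cast
      linarith
    have hmr := hm hyI
    obtain ⟨hy0, hy1⟩ := hy
    rw [hmb] at hmr ⊢
    obtain ⟨h0, h1⟩ := hmr
    rcases Int.isUnit_iff.1 (IsUnit.of_mul_eq_one m' (by rwa [mul_comm] at hmm)) with rfl | rfl
    · left
      push_cast at *
      have hb0 : -1 < b := by exact_mod_cast (by linarith : (-1 : ℝ) < b)
      have hb1 : b < 1 := by exact_mod_cast (by linarith : (b : ℝ) < 1)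
      have : b = 0 := by omega
      simp [this]
    · right
      push_cast at *
      have hb0 : 0 < b := by exact_mod_cast (by linarith : (0 : ℝ) < b)
      have hb1 : b < 2 := by exact_mod_cast (by linarith : (b : ℝ) < 2)
      have : b = 1 := by omega
      simp [this]
      ring
  have hdense : ∀ (z : ℝ) (u : ℝ → ℝ), Continuous u →
      (∀ y ∈ Ioo 0 r, Irrational y → y ≠ z → g y = u y) → ∀ y ∈ Icc 0 r, g y = u y := by
    intro z u hu h
    have hD : Dense ({x : ℝ | Irrational x} \ {z}) := dense_irrational.sdiff_singleton z
    have hcl : Icc 0 r ⊆ closure (Ioo 0 r ∩ ({x : ℝ | Irrational x} \ {z})) := by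
      rw [← closure_Ioo hr0.ne]
      exact closure_minimal (hD.open_subset_closure_inter isOpen_Ioo) isClosed_closure
    have hEq : EqOn g u (Ioo 0 r ∩ ({x : ℝ | Irrational x} \ {z})) :=
      fun y hy => h y hy.1 hy.2.1 hy.2.2
    exact hEq.of_subset_closure hc hu.continuousOn
      (inter_subset_left.trans Ioo_subset_Icc_self) hcl
  have hcase : StrictMonoOn g (Icc 0 r) ∨ StrictAntiOn g (Icc 0 r) :=
    ContinuousOn.strictMonoOn_of_injOn_Icc' hr0.le hc hinj
  rcases hcase with hmono | hanti
  · left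
    by_cases hex : ∃ z ∈ Ioo 0 r, g z = 1 - z
    · obtain ⟨z, hz, hgz⟩ := hex
      refine hdense z _ continuous_id fun y hy hyi hyz => (hirr y hy hyi).resolve_right fun h => ?_
      rcases lt_or_gt_of_ne hyz with hlt | hlt
      · have := hmono (Ioo_subset_Icc_self hy) (Ioo_subset_Icc_self hz) hlt
        linarith
      · have := hmono (Ioo_subset_Icc_self hz) (Ioo_subset_Icc_self hy) hlt
        linarith
    · push Not at hex
      exact hdense 0 _ continuous_id fun y hy hyi _ => (hirr y hy hyi).resolve_right (hex y hy)
  · right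
    by_cases hex : ∃ z ∈ Ioo 0 r, g z = z
    · obtain ⟨z, hz, hgz⟩ := hex
      refine hdense z _ (continuous_const.sub continuous_id) fun y hy hyi hyz =>
        (hirr y hy hyi).resolve_left fun h => ?_
      rcases lt_or_gt_of_ne hyz with hlt | hlt
      · have := hanti (Ioo_subset_Icc_self hy) (Ioo_subset_Icc_self hz) hlt
        linarith
      · have := hanti (Ioo_subset_Icc_self hz) (Ioo_subset_Icc_self hy) hlt
        linarith
    · push Not at hex
      exact hdense 0 _ (continuous_const.sub continuous_id) fun y hy hyi _ =>
        (hirr y hy hyi).resolve_left (hex y hy)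

theorem isRationalPolyhedron_seg {a b : ℚ} (h : a < b) :
    IsRationalPolyhedron (seg (a : ℝ) (b : ℝ)) := by
  classical
  refine ⟨{{fun _ => (a : ℝ), fun _ => (b : ℝ)}}, ?_, ?_⟩
  · simp only [Finset.mem_singleton]
    rintro F rfl v hv i
    simp only [Finset.mem_insert, Finset.mem_singleton] at hv
    rcases hv with rfl | rfl
    exacts [⟨a, rfl⟩, ⟨b, rfl⟩]
  · have hab : (0 : ℝ) < b - a := sub_pos.2 (by exact_mod_cast h)
    simp only [Finset.mem_singleton, iUnion_iUnion_eq_left, Finset.coe_insert,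
      Finset.coe_singleton, convexHull_pair]
    ext v
    constructor
    · rintro ⟨h1, h2⟩
      refine ⟨(b - v 0) / (b - a), (v 0 - a) / (b - a), div_nonneg (by linarith) hab.le,
        div_nonneg (by linarith) hab.le, by field_simp; ring, ?_⟩
      rw [← const_apply_zero v]
      funext i
      simp only [Pi.add_apply, Pi.smul_apply, smul_eq_mul]
      field_simp
      ring
    · rintro ⟨s, t, hs, ht, hst, rfl⟩
      simp only [seg, mem_ofPred_eq, Pi.add_apply, Pi.smul_apply, smul_eq_mul]
      obtain rfl : s = 1 - t := by linarith
      constructor <;> nlinarith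

theorem isZHomeoDomain_of_inverse {σ g : (Fin 1 → ℝ) → (Fin 1 → ℝ)} {Q : Set (Fin 1 → ℝ)}
    (hσ : IsZMapOn (cubeSet 1) σ) (hP : IsRationalPolyhedron Q) (hQ : Q ⊆ cubeSet 1)
    (hg : IsZMapOn (zRange σ) g) (hgm : MapsTo g (zRange σ) Q)
    (hgσ : ∀ x ∈ Q, g (σ x) = x) (hσg : ∀ y ∈ zRange σ, σ (g y) = y) : IsZHomeoDomain σ Q := by
  refine ⟨hP, hQ, hσ.mono hQ, Subset.antisymm (image_mono hQ) fun y hy => ⟨g y, hgm hy, hσg y hy⟩,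
    fun x hx y hy hxy => ?_, g, hg, hgσ, hσg⟩
  rw [← hgσ x hx, ← hgσ y hy, hxy]

theorem IsZRetraction.apply_of_mem_zRange {n : ℕ} {σ : (Fin n → ℝ) → (Fin n → ℝ)}
    (hσ : IsZRetraction σ) {y : Fin n → ℝ} (hy : y ∈ zRange σ) : σ y = y := by
  obtain ⟨x, hx, rfl⟩ := hy
  exact hσ.2.2 x hx

theorem isZHomeoDomain_seg {r : ℚ} (hr0 : 0 < r) (hr1 : (r : ℝ) ≤ 1)
    {σ : (Fin 1 → ℝ) → (Fin 1 → ℝ)} (hσ : IsZRetraction σ) (hR : zRange σ = seg 0 (r : ℝ)) :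
    IsZHomeoDomain σ (seg 0 (r : ℝ)) := by
  have hsub : seg 0 (r : ℝ) ⊆ cubeSet 1 := seg_subset_cubeSet le_rfl hr1
  have hfix : ∀ y ∈ seg 0 (r : ℝ), σ y = y := fun y hy =>
    hσ.apply_of_mem_zRange (hR ▸ hy)
  have hP : IsRationalPolyhedron (seg 0 (r : ℝ)) := by
    simpa using isRationalPolyhedron_seg hr0
  refine isZHomeoDomain_of_inverse (g := σ) hσ.1 hP hsub ?_ ?_ ?_ ?_
  · rw [hR]
    exact hσ.1.mono hsub
  · rw [hR]
    exact fun y hy => by rwa [hfix y hy]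
  · exact fun x hx => by rw [hfix x hx, hfix x hx]
  · rw [hR]
    exact fun x hx => by rw [hfix x hx, hfix x hx]

theorem IsZHomeoDomain.eq_seg {r : ℝ} (hr0 : 0 < r) (hr1 : r ≤ 1)
    {σ : (Fin 1 → ℝ) → (Fin 1 → ℝ)} (hR : zRange σ = seg 0 r) {Q : Set (Fin 1 → ℝ)}
    (hQ : IsZHomeoDomain σ Q) :
    Q = seg 0 r ∨
      Q = seg (1 - r) 1 ∧ ∀ t ∈ Icc 0 r, σ (fun _ => 1 - t) = fun _ => t := by
  obtain ⟨-, hQc, hσ, himg, -, g, hg, hgσ, hσg⟩ := hQ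
  rw [hR] at himg hg hσg
  have hgQ : ∀ y ∈ seg 0 r, g y ∈ Q := by
    intro y hy
    rw [← himg] at hy
    obtain ⟨x, hx, rfl⟩ := hy
    rwa [hgσ x hx]
  have hmem : ∀ t ∈ Icc 0 r, (fun _ => t : Fin 1 → ℝ) ∈ seg 0 r := fun t ht => ht
  have key := eq_id_or_eq_one_sub hr0 hr1 (g := fun t => g (fun _ => t) 0)
    ((continuous_apply 0).comp_continuousOn (hg.1.comp (by fun_prop) hmem))
    (fun t ht => mem_cubeSet_one.1 (hQc (hgQ _ (hmem t ht))))
    (fun s hs t ht hst => by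
      have h : g (fun _ => s) = g (fun _ => t) := by
        rw [← const_apply_zero (g fun _ => s), ← const_apply_zero (g fun _ => t)]
        exact funext fun _ => hst
      have h' := congrArg σ h
      rw [hσg _ (hmem s hs), hσg _ (hmem t ht)] at h'
      exact congrFun h' 0)
    (fun t ht => hg.exists_int (hmem t ht))
    (fun t ht => by
      obtain ⟨m, b, h⟩ := hσ.exists_int (hgQ _ (hmem t ht))
      rw [hσg _ (hmem t ht)] at h
      exact ⟨m, b, h⟩)
  have hQeq : Q = g '' seg 0 r := by
    rw [← himg, image_image]
    exact (image_congr hgσ |>.trans (image_id' Q)).symm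
  rcases key with h | h
  · left
    have hfix : ∀ y ∈ seg 0 r, g y = y := by
      intro y hy
      have := h (y 0) hy
      rw [const_apply_zero] at this
      rw [← const_apply_zero (g y), this, const_apply_zero]
    rw [hQeq, image_congr hfix, image_id']
  · right
    have hrefl : ∀ y ∈ seg 0 r, g y = fun _ => 1 - y 0 := by
      intro y hy
      rw [← const_apply_zero (g y)]
      have := h (y 0) hy
      rw [const_apply_zero] at this
      exact funext fun _ => this
    constructor
    · rw [hQeq, image_congr hrefl]
      ext v
      constructor
      · rintro ⟨y, ⟨h0, h1⟩, rfl⟩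
        constructor <;> dsimp only <;> linarith
      · rintro ⟨h0, h1⟩
        refine ⟨fun _ => 1 - v 0, ⟨by linarith, by linarith⟩, ?_⟩
        rw [← const_apply_zero v]
        funext
        ring
    · intro t ht
      rw [← hrefl _ (hmem t ht), hσg _ (hmem t ht)]

theorem exists_zFun_retraction {r : ℚ} (hr0 : 0 < r) :
    ∃ s : ℝ → ℝ, IsZFun (Icc 0 1) s ∧ (∀ y ∈ Icc 0 (r : ℝ), s y = y) ∧
      MapsTo s (Icc 0 1) (Icc 0 (r : ℝ)) := by
  have hden : (1 : ℝ) ≤ r.den := by exact_mod_cast r.den_pos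
  have hnum : (r.num : ℝ) = r.den * r := by
    rw [mul_comm]
    exact_mod_cast (Rat.mul_den_eq_num r).symm
  have hr : (0 : ℝ) < r := by exact_mod_cast hr0
  refine ⟨fun y => max 0 (min y (((1 - r.den : ℤ) : ℝ) * y + (r.num : ℝ))),
    (IsZFun.zero _).sup ((IsZFun.id _).inf (IsZFun.affine _ _ _)), fun y hy => ?_, fun y hy => ?_⟩
  · push_cast
    rw [min_eq_left, max_eq_right hy.1]
    rw [hnum]
    nlinarith [mul_nonneg (sub_nonneg.2 hy.2) (zero_le_one.trans hden)]
  · refine ⟨le_max_left _ _, max_le hr.le ?_⟩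
    push_cast
    rcases le_total y r with h | h
    · exact (min_le_left _ _).trans h
    · refine (min_le_right _ _).trans ?_
      rw [hnum]
      nlinarith [mul_nonneg (sub_nonneg.2 h) (sub_nonneg.2 hden)]

theorem exists_symm_zFun_retraction {r : ℚ} (hr0 : 0 < r) (hr : (r : ℝ) ≤ 1 / 2) :
    ∃ s : ℝ → ℝ, IsZFun (Icc 0 1) s ∧ (∀ y ∈ Icc 0 (r : ℝ), s y = y) ∧
      MapsTo s (Icc 0 1) (Icc 0 (r : ℝ)) ∧ ∀ y, s (1 - y) = s y := by
  obtain ⟨s, hs, hfix, hm⟩ := exists_zFun_retraction hr0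
  have hmin : MapsTo (fun y : ℝ => min y (1 - y)) (Icc 0 1) (Icc 0 1) := fun y hy =>
    ⟨le_min hy.1 (sub_nonneg.2 hy.2), (min_le_left _ _).trans hy.2⟩
  refine ⟨fun y => s (min y (1 - y)), hs.comp ((IsZFun.id _).inf (IsZFun.id _).one_sub) hmin,
    fun y hy => ?_, hm.comp hmin, fun y => ?_⟩
  · dsimp only
    rw [min_eq_left (by linarith [hy.2]), hfix y hy]
  · dsimp only
    rw [sub_sub_cancel, min_comm]

theorem isZRetraction_of_zFun {r : ℝ} (hr1 : r ≤ 1) {s : ℝ → ℝ} (hs : IsZFun (Icc 0 1) s)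
    (hfix : ∀ y ∈ Icc 0 r, s y = y) (hm : MapsTo s (Icc 0 1) (Icc 0 r)) :
    IsZRetraction (fun (v : Fin 1 → ℝ) (_ : Fin 1) => s (v 0)) ∧
      zRange (fun (v : Fin 1 → ℝ) (_ : Fin 1) => s (v 0)) = seg 0 r := by
  refine ⟨⟨?_, fun v hv => ?_, fun v hv => ?_⟩, Subset.antisymm ?_ ?_⟩
  · rw [cubeSet_one_eq]
    exact hs.isZMapOn
  · exact seg_subset_cubeSet le_rfl hr1 (hm (mem_cubeSet_one.1 hv))
  · exact funext fun _ => hfix _ (hm (mem_cubeSet_one.1 hv))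
  · rintro _ ⟨v, hv, rfl⟩
    exact hm (mem_cubeSet_one.1 hv)
  · intro v hv
    refine ⟨v, seg_subset_cubeSet le_rfl hr1 hv, ?_⟩
    rw [← const_apply_zero v]
    exact funext fun _ => hfix _ hv

theorem isZHomeoDomain_seg_one_sub {r : ℚ} (hr0 : 0 < r) (hr1 : (r : ℝ) ≤ 1) {s : ℝ → ℝ}
    (hs : IsZFun (Icc 0 1) s) (hfix : ∀ y ∈ Icc 0 (r : ℝ), s y = y)
    (hm : MapsTo s (Icc 0 1) (Icc 0 (r : ℝ))) (hsymm : ∀ y, s (1 - y) = s y) :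
    IsZHomeoDomain (fun (v : Fin 1 → ℝ) (_ : Fin 1) => s (v 0)) (seg (1 - (r : ℝ)) 1) := by
  obtain ⟨hσ, hR⟩ := isZRetraction_of_zFun hr1 hs hfix hm
  have hP : IsRationalPolyhedron (seg (1 - (r : ℝ)) 1) := by
    simpa using isRationalPolyhedron_seg (sub_lt_self 1 hr0)
  refine isZHomeoDomain_of_inverse (g := fun v (_ : Fin 1) => 1 - v 0) hσ.1 hP
    (seg_subset_cubeSet (sub_nonneg.2 hr1) le_rfl) ?_ ?_ ?_ ?_
  · exact (IsZFun.id univ).one_sub.isZMapOn.mono fun _ _ => mem_univ _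
  · rw [hR]
    rintro v ⟨h0, h1⟩
    constructor <;> dsimp only <;> linarith
  · rintro v ⟨h0, h1⟩
    rw [← const_apply_zero v]
    funext
    rw [← hsymm, hfix (1 - v 0) ⟨by linarith, by linarith⟩]
    ring
  · rw [hR]
    intro v hv
    rw [← const_apply_zero v]
    funext
    rw [hsymm]
    exact hfix _ hv

/-- Composition with a one-variable Z-map, as an operation on `McN 1`. -/
noncomputable def compMcN (s : ℝ → ℝ) (hs : IsZFun (Icc 0 1) s)
    (hm : MapsTo s (Icc 0 1) (Icc 0 1)) (f : ↥(McN 1)) : ↥(McN 1) :=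
  ⟨fun x => f.1 (cubePt (s (x.1 0))), by
    obtain ⟨F, hF, hFm, hfF⟩ := mem_McN_one.1 f.2
    refine mem_McN_one.2 ⟨_, hF.comp hs hm, hFm.comp hm, fun x => ?_⟩
    rw [hfF, cubePt_apply (hm (mem_cubeSet_one.1 x.2))]⟩

theorem isMcNRetraction_compMcN {s : ℝ → ℝ} (hs : IsZFun (Icc 0 1) s)
    (hm : MapsTo s (Icc 0 1) (Icc 0 1)) (hss : ∀ t ∈ Icc (0 : ℝ) 1, s (s t) = s t) :
    IsMcNRetraction (compMcN s hs hm) (Subtype.val '' Set.range (compMcN s hs hm)) := by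
  refine ⟨fun f g h => rfl, fun f h => rfl, fun f => Subtype.ext (funext fun x => ?_), rfl⟩
  have hx := mem_cubeSet_one.1 x.2
  simp only [compMcN]
  rw [cubePt_apply (hm hx), hss _ hx]

theorem IsMcNRetraction.mem {n : ℕ} {ε : ↥(McN n) → ↥(McN n)} {A : Set (↥(cubeSet n) → ℝ)}
    (hε : IsMcNRetraction ε A) (f : ↥(McN n)) : (ε f).1 ∈ A := by
  rw [← hε.2.2.2]
  exact ⟨_, ⟨f, rfl⟩, rfl⟩

/-- A retraction onto a copy of `McNSeg r`, read through the isomorphism, is restriction to `[0,r]`,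
possibly after the reflection of the unit interval. -/
theorem IsMcNRetraction.iso_apply {r : ℝ} (hr0 : 0 < r) (hr1 : r ≤ 1)
    {A : Set (↥(cubeSet 1) → ℝ)} {h : ↥A → ↥(McNSeg r)} (hh : IsMVIsoFun A (McNSeg r) h)
    {ε : ↥(McN 1) → ↥(McN 1)} (hε : IsMcNRetraction ε A) :
    (∀ f y, (h ⟨_, hε.mem f⟩).1 y = f.1 (cubePt (y.1 0))) ∨
      (∀ f y, (h ⟨_, hε.mem f⟩).1 y = f.1 (cubePt (1 - y.1 0))) := by
  have hseg : ∀ f : ↥(McNSeg r), ∀ y, f.1 y ∈ Icc (0 : ℝ) 1 := by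
    intro f y
    obtain ⟨F, -, hFm, hfF⟩ := mem_McNSeg.1 f.2
    rw [hfF]
    exact hFm (mem_cubeSet_one.1 (seg_subset_cubeSet le_rfl hr1 y.2))
  have heval : ∀ f y,
      (h ⟨_, hε.mem f⟩).1 y = f.1 (cubePt ((h ⟨_, hε.mem coordMcN⟩).1 y)) := by
    intro f y
    refine hom_eq_eval (φ := fun f => (h ⟨_, hε.mem f⟩).1 y) (fun f => hseg _ _)
      (fun f g hfg => ?_) (fun f hf => ?_) f
    · have e := hε.1 f g hfg
      have hA : mvAdd (ε f).1 (ε g).1 ∈ A := e ▸ hε.mem _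
      have := hh.2.1 ⟨_, hε.mem f⟩ ⟨_, hε.mem g⟩ hA
      calc _ = (h ⟨_, hA⟩).1 y := congrArg (fun a => (h a).1 y) (Subtype.ext e)
        _ = _ := by rw [this]; rfl
    · have e := hε.2.1 f hf
      have hA : mvNeg (ε f).1 ∈ A := e ▸ hε.mem _
      have := hh.2.2 ⟨_, hε.mem f⟩ hA
      calc _ = (h ⟨_, hA⟩).1 y := congrArg (fun a => (h a).1 y) (Subtype.ext e)
        _ = _ := by rw [this]; rfl
  obtain ⟨G, hG, hGm, hgG⟩ := mem_McNSeg.1 (h ⟨_, hε.mem coordMcN⟩).2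
  obtain ⟨f, hf⟩ : ∃ f, (h ⟨_, hε.mem f⟩).1 = fun y : ↥(seg 0 r) => y.1 0 := by
    have hid : (fun y : ↥(seg 0 r) => y.1 0) ∈ McNSeg r :=
      mem_McNSeg.2 ⟨fun t => t, IsZFun.id _, fun _ ht => ht, fun _ => rfl⟩
    obtain ⟨⟨a, ha⟩, hha⟩ := hh.1.2 ⟨_, hid⟩
    have ha' := ha
    rw [← hε.2.2.2] at ha'
    obtain ⟨_, ⟨f, rfl⟩, rfl⟩ := ha'
    exact ⟨f, congrArg Subtype.val hha⟩
  obtain ⟨F, hF, hFm, hfF⟩ := mem_McN_one.1 f.2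
  have hIcc : Icc 0 r ⊆ Icc (0 : ℝ) 1 := Icc_subset_Icc_right hr1
  have hFG : ∀ t ∈ Icc 0 r, t = F (G t) := by
    intro t ht
    have h1 := heval f ⟨fun _ => t, ht⟩
    rw [hf, hgG, hfF] at h1
    rwa [cubePt_apply (hGm (hIcc ht))] at h1
  have key := eq_id_or_eq_one_sub hr0 hr1 (hG.1.mono hIcc) (hGm.mono_left hIcc)
    (fun s hs t ht hst => by rw [hFG s hs, hFG t ht, hst])
    (fun t ht => by
      obtain ⟨-, T, -, hT⟩ := hG
      obtain ⟨p, -, hp⟩ := hT t (hIcc ht)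
      exact ⟨p.1, p.2, hp⟩)
    (fun t ht => by
      obtain ⟨-, T, -, hT⟩ := hF
      obtain ⟨p, -, hp⟩ := hT (G t) (hGm (hIcc ht))
      exact ⟨p.1, p.2, (hFG t ht).trans hp⟩)
  refine key.imp (fun k f y => ?_) (fun k f y => ?_) <;>
  rw [heval, hgG, k _ y.2]

theorem IsMcNRetraction.eq_of_iso_eq {r : ℝ} {A : Set (↥(cubeSet 1) → ℝ)} {h : ↥A → ↥(McNSeg r)}
    (hh : IsMVIsoFun A (McNSeg r) h) {ε ε' : ↥(McN 1) → ↥(McN 1)} (hε : IsMcNRetraction ε A)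
    (hε' : IsMcNRetraction ε' A)
    (hEq : ∀ f y, (h ⟨_, hε.mem f⟩).1 y = (h ⟨_, hε'.mem f⟩).1 y) : ε = ε' := by
  funext f
  have := hh.1.1 (Subtype.ext (funext (hEq f)))
  exact Subtype.ext (Subtype.mk_eq_mk.1 this)

/-- For `1/2 < r`, the two possible forms of a retraction cannot both occur. -/
theorem IsMcNRetraction.false_of_restrict_of_reflect {r : ℝ} (hr : 1 / 2 < r) (hr1 : r ≤ 1)
    {A : Set (↥(cubeSet 1) → ℝ)} {h : ↥A → ↥(McNSeg r)} (hh : IsMVIsoFun A (McNSeg r) h)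
    {ε ε' : ↥(McN 1) → ↥(McN 1)} (hε : IsMcNRetraction ε A) (hε' : IsMcNRetraction ε' A)
    (h1 : ∀ f y, (h ⟨_, hε.mem f⟩).1 y = f.1 (cubePt (y.1 0)))
    (h2 : ∀ f y, (h ⟨_, hε'.mem f⟩).1 y = f.1 (cubePt (1 - y.1 0))) : False := by
  have hid : (fun y : ↥(seg 0 r) => y.1 0) ∈ McNSeg r :=
    mem_McNSeg.2 ⟨fun t => t, IsZFun.id _, fun _ ht => ht, fun _ => rfl⟩
  obtain ⟨⟨a, ha⟩, hha⟩ := hh.1.2 ⟨_, hid⟩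
  have hfix : ∀ {δ : ↥(McN 1) → ↥(McN 1)}, IsMcNRetraction δ A →
      ∃ f : ↥(McN 1), f.1 = a ∧ δ f = f := by
    intro δ hδ
    have ha' := ha
    rw [← hδ.2.2.2] at ha'
    obtain ⟨_, ⟨f, rfl⟩, hf⟩ := ha'
    exact ⟨δ f, hf, hδ.2.2.1 f⟩
  obtain ⟨f, hfa, hf⟩ := hfix hε
  obtain ⟨f', hfa', hf'⟩ := hfix hε'
  have k1 : ∀ y : ↥(seg 0 r), y.1 0 = a (cubePt (y.1 0)) := by
    intro y
    have e : (⟨_, hε.mem f⟩ : ↥A) = ⟨a, ha⟩ := Subtype.ext ((congrArg Subtype.val hf).trans hfa)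
    have := h1 f y
    rwa [e, hha, hfa] at this
  have k2 : ∀ y : ↥(seg 0 r), y.1 0 = a (cubePt (1 - y.1 0)) := by
    intro y
    have e : (⟨_, hε'.mem f'⟩ : ↥A) = ⟨a, ha⟩ := Subtype.ext ((congrArg Subtype.val hf').trans hfa')
    have := h2 f' y
    rwa [e, hha, hfa'] at this
  have e1 := k1 ⟨fun _ => 1 - r, by constructor <;> dsimp only <;> linarith⟩
  have e2 := k2 ⟨fun _ => r, by constructor <;> dsimp only <;> linarith⟩
  dsimp only at e1 e2
  linarith

theorem card_retractions_le {r : ℝ} (hr0 : 0 < r) (hr1 : r ≤ 1)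
    {A : Set (↥(cubeSet 1) → ℝ)} {h : ↥A → ↥(McNSeg r)} (hh : IsMVIsoFun A (McNSeg r) h) :
    Finite {ε : ↥(McN 1) → ↥(McN 1) // IsMcNRetraction ε A} ∧
      Nat.card {ε : ↥(McN 1) → ↥(McN 1) // IsMcNRetraction ε A} ≤
        (if r ≤ 1/2 then 2 else 1) := by
  classical
  have hinj : Function.Injective
      (fun ε : {ε : ↥(McN 1) → ↥(McN 1) // IsMcNRetraction ε A} =>
        decide (∀ f y, (h ⟨_, ε.2.mem f⟩).1 y = f.1 (cubePt (y.1 0)))) := by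
    rintro ⟨ε, hε⟩ ⟨ε', hε'⟩ heq
    refine Subtype.ext (hε.eq_of_iso_eq hh hε' fun f y => ?_)
    rw [decide_eq_decide] at heq
    by_cases hc : ∀ f y, (h ⟨_, hε.mem f⟩).1 y = f.1 (cubePt (y.1 0))
    · rw [hc, heq.1 hc]
    · rw [(hε.iso_apply hr0 hr1 hh).resolve_left hc,
        (hε'.iso_apply hr0 hr1 hh).resolve_left (fun h' => hc (heq.2 h'))]
  have hfin := Finite.of_injective _ hinj
  refine ⟨hfin, ?_⟩
  split_ifs with hr
  · simpa using Nat.card_le_card_of_injective _ hinj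
  · rw [Finite.card_le_one_iff_subsingleton]
    constructor
    rintro ⟨ε, hε⟩ ⟨ε', hε'⟩
    refine Subtype.ext (hε.eq_of_iso_eq hh hε' fun f y => ?_)
    rcases hε.iso_apply hr0 hr1 hh with h1 | h1 <;>
      rcases hε'.iso_apply hr0 hr1 hh with h2 | h2
    · rw [h1, h2]
    · exact (hε.false_of_restrict_of_reflect (not_le.1 hr) hr1 hh hε' h1 h2).elim
    · exact (hε'.false_of_restrict_of_reflect (not_le.1 hr) hr1 hh hε h2 h1).elim
    · rw [h1, h2]

theorem exists_iso_range_compMcN {r : ℝ} (hr1 : r ≤ 1) {s : ℝ → ℝ} (hs : IsZFun (Icc 0 1) s)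
    (hm : MapsTo s (Icc 0 1) (Icc 0 1)) (hfix : ∀ y ∈ Icc 0 r, s y = y)
    (hmr : MapsTo s (Icc 0 1) (Icc 0 r)) :
    ∃ h : ↥(Subtype.val '' Set.range (compMcN s hs hm)) → ↥(McNSeg r),
      IsMVIsoFun (Subtype.val '' Set.range (compMcN s hs hm)) (McNSeg r) h := by
  have hres : ∀ a ∈ Subtype.val '' Set.range (compMcN s hs hm),
      (fun y : ↥(seg 0 r) => a (cubePt (y.1 0))) ∈ McNSeg r := by
    rintro _ ⟨f, -, rfl⟩
    obtain ⟨F, hF, hFm, hfF⟩ := mem_McN_one.1 f.2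
    refine mem_McNSeg.2 ⟨F, hF, hFm, fun y => ?_⟩
    rw [hfF, cubePt_apply (mem_cubeSet_one.1 (seg_subset_cubeSet le_rfl hr1 y.2))]
  refine ⟨fun a => ⟨_, hres a.1 a.2⟩, ⟨?_, ?_⟩, fun _ _ _ => rfl, fun _ _ => rfl⟩
  · rintro ⟨_, _, ⟨f, rfl⟩, rfl⟩ ⟨_, _, ⟨g, rfl⟩, rfl⟩ hEq
    refine Subtype.ext (funext fun x => ?_)
    have hx := mem_cubeSet_one.1 x.2
    have := congrFun (congrArg Subtype.val hEq) ⟨fun _ => s (x.1 0), hmr hx⟩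
    simpa only [compMcN, cubePt_apply (hm hx), hfix _ (hmr hx)] using this
  · rintro ⟨a, ha⟩
    obtain ⟨F, hF, hFm, haF⟩ := mem_McNSeg.1 ha
    have hFM : (fun x : ↥(cubeSet 1) => F (x.1 0)) ∈ McN 1 :=
      mem_McN_one.2 ⟨F, hF, hFm, fun _ => rfl⟩
    refine ⟨⟨_, _, ⟨⟨_, hFM⟩, rfl⟩, rfl⟩, Subtype.ext (funext fun y => ?_)⟩
    have hy : y.1 0 ∈ Icc (0 : ℝ) 1 := mem_cubeSet_one.1 (seg_subset_cubeSet le_rfl hr1 y.2)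
    simp only [compMcN]
    rw [cubePt_apply hy, hfix _ y.2, cubePt_apply hy, haF]

/-- For rational `0 < r ≤ 1`: if `r ≤ 1/2` there is a Z-retraction of `[0,1]`
onto `[0,r]` with exactly the two Z-homeomorphism domains `[0,r]`, `[1-r,1]`, and every
Z-retraction onto `[0,r]` has its domains among these two; if `r > 1/2` every Z-retraction
onto `[0,r]` has `[0,r]` as its unique domain. In particular the index of `McN([0,r])`
equals 2 if `r ≤ 1/2` and 1 if `r > 1/2`. -/
theorem stmt9 (r : ℚ) (hr0 : 0 < r) (hr1 : (r : ℝ) ≤ 1) :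
    ((r : ℝ) ≤ 1/2 →
      (∃ σ, IsZRetraction σ ∧ zRange σ = seg 0 (r : ℝ) ∧
        {Q : Set (Fin 1 → ℝ) | IsZHomeoDomain σ Q} =
          {seg 0 (r : ℝ), seg (1 - (r : ℝ)) 1}) ∧
      (∀ σ, IsZRetraction σ → zRange σ = seg 0 (r : ℝ) →
        ∀ Q, IsZHomeoDomain σ Q → Q = seg 0 (r : ℝ) ∨ Q = seg (1 - (r : ℝ)) 1)) ∧
    (1/2 < (r : ℝ) →
      ∀ σ, IsZRetraction σ → zRange σ = seg 0 (r : ℝ) →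
        {Q : Set (Fin 1 → ℝ) | IsZHomeoDomain σ Q} = {seg 0 (r : ℝ)}) ∧
    (∀ A : Set (↥(cubeSet 1) → ℝ), (∃ ε, IsMcNRetraction ε A) →
      (∃ h : ↥A → ↥(McNSeg (r : ℝ)), IsMVIsoFun A (McNSeg (r : ℝ)) h) →
      Nat.card {ε : ↥(McN 1) → ↥(McN 1) // IsMcNRetraction ε A} ≤
        (if (r : ℝ) ≤ 1/2 then 2 else 1)) ∧
    (∃ A : Set (↥(cubeSet 1) → ℝ), (∃ ε, IsMcNRetraction ε A) ∧
      (∃ h : ↥A → ↥(McNSeg (r : ℝ)), IsMVIsoFun A (McNSeg (r : ℝ)) h) ∧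
      Nat.card {ε : ↥(McN 1) → ↥(McN 1) // IsMcNRetraction ε A} =
        (if (r : ℝ) ≤ 1/2 then 2 else 1)) := by
  have hr : (0 : ℝ) < r := by exact_mod_cast hr0
  have hIcc : Icc 0 (r : ℝ) ⊆ Icc 0 1 := Icc_subset_Icc_right hr1
  refine ⟨fun hr2 => ⟨?_, fun σ _ hR Q hQ => ?_⟩, fun hr2 σ hσ hR => ?_, fun A _ ⟨h, hh⟩ => ?_, ?_⟩
  · obtain ⟨s, hs, hfix, hm, hsymm⟩ := exists_symm_zFun_retraction hr0 hr2
    obtain ⟨hσ, hR⟩ := isZRetraction_of_zFun hr1 hs hfix hm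
    refine ⟨_, hσ, hR, Set.ext fun Q => ⟨fun hQ => ?_, ?_⟩⟩
    · exact (IsZHomeoDomain.eq_seg hr hr1 hR hQ).imp id And.left
    · rintro (rfl | rfl)
      · exact isZHomeoDomain_seg hr0 hr1 hσ hR
      · exact isZHomeoDomain_seg_one_sub hr0 hr1 hs hfix hm hsymm
  · exact (hQ.eq_seg hr hr1 hR).imp id And.left
  · refine Set.ext fun Q => ⟨fun hQ => ?_, ?_⟩
    · refine (IsZHomeoDomain.eq_seg hr hr1 hR hQ).resolve_right fun ⟨_, h⟩ => ?_
      have h1 := h r ⟨hr.le, le_rfl⟩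
      have h2 : σ (fun _ => 1 - (r : ℝ)) = fun _ => 1 - (r : ℝ) := by
        apply hσ.apply_of_mem_zRange
        rw [hR]
        constructor <;> dsimp only <;> linarith
      have := congrFun (h1.symm.trans h2) 0
      linarith
    · rintro rfl
      exact isZHomeoDomain_seg hr0 hr1 hσ hR
  · exact (card_retractions_le hr hr1 hh).2
  · by_cases hr2 : (r : ℝ) ≤ 1 / 2
    · obtain ⟨s, hs, hfix, hm, hsymm⟩ := exists_symm_zFun_retraction hr0 hr2
      have hm1 := hm.mono_right hIcc
      have hss : ∀ t ∈ Icc (0 : ℝ) 1, s (s t) = s t := fun t ht => hfix _ (hm ht)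
      obtain ⟨h, hh⟩ := exists_iso_range_compMcN hr1 hs hm1 hfix hm
      have hε := isMcNRetraction_compMcN hs hm1 hss
      have hm' : MapsTo (fun t => 1 - s t) (Icc 0 1) (Icc 0 1) := fun t ht =>
        ⟨sub_nonneg.2 (hm1 ht).2, sub_le_self _ (hm1 ht).1⟩
      have hε' := isMcNRetraction_compMcN hs.one_sub hm'
        (fun t ht => by rw [hsymm, hss t ht])
      have hrefl : MapsTo (fun t : ℝ => 1 - t) (Icc 0 1) (Icc 0 1) := fun t ht =>
        ⟨sub_nonneg.2 ht.2, sub_le_self _ ht.1⟩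
      have hcomp : ∀ f, compMcN s hs hm1 (compMcN _ (IsZFun.id _).one_sub hrefl f) =
          compMcN _ hs.one_sub hm' f := fun f => Subtype.ext (funext fun x => by
        simp only [compMcN, cubePt_apply (hm1 (mem_cubeSet_one.1 x.2))])
      have hcomp' : ∀ f, compMcN _ hs.one_sub hm' (compMcN _ (IsZFun.id _).one_sub hrefl f) =
          compMcN s hs hm1 f := fun f => Subtype.ext (funext fun x => by
        simp only [compMcN, cubePt_apply (hm' (mem_cubeSet_one.1 x.2)), sub_sub_cancel])
      have hrange : Set.range (compMcN _ hs.one_sub hm') = Set.range (compMcN s hs hm1) :=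
        Subset.antisymm (by rintro _ ⟨f, rfl⟩; exact ⟨_, hcomp f⟩)
          (by rintro _ ⟨f, rfl⟩; exact ⟨_, hcomp' f⟩)
      rw [hrange] at hε'
      refine ⟨_, ⟨_, hε⟩, ⟨h, hh⟩, ?_⟩
      obtain ⟨hfin, hle⟩ := card_retractions_le hr hr1 hh
      refine le_antisymm hle ?_
      rw [if_pos hr2]
      refine Nat.succ_le_of_lt (Finite.one_lt_card_iff_nontrivial.2 ⟨⟨_, hε⟩, ⟨_, hε'⟩, fun e => ?_⟩)
      have e0 := congrFun (congrArg Subtype.val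
        (congrFun (congrArg Subtype.val e) coordMcN)) (cubePt 0)
      have h0 : (0 : ℝ) ∈ Icc (0 : ℝ) 1 := ⟨le_rfl, zero_le_one⟩
      have hs0 : s 0 = 0 := hfix 0 ⟨le_rfl, hr.le⟩
      simp only [compMcN, coordMcN, cubePt_apply h0, hs0, sub_zero,
        cubePt_apply (show (1 : ℝ) ∈ Icc (0 : ℝ) 1 from ⟨zero_le_one, le_rfl⟩)] at e0
      exact zero_ne_one e0
    · obtain ⟨s, hs, hfix, hm⟩ := exists_zFun_retraction hr0
      have hm1 := hm.mono_right hIcc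
      obtain ⟨h, hh⟩ := exists_iso_range_compMcN hr1 hs hm1 hfix hm
      have hε := isMcNRetraction_compMcN hs hm1 (fun t ht => hfix _ (hm ht))
      refine ⟨_, ⟨_, hε⟩, ⟨h, hh⟩, ?_⟩
      obtain ⟨hfin, hle⟩ := card_retractions_le hr hr1 hh
      refine le_antisymm hle ?_
      rw [if_neg hr2]
      have : Nonempty {ε : ↥(McN 1) → ↥(McN 1) // IsMcNRetraction ε _} := ⟨⟨_, hε⟩⟩
      exact Nat.card_pos
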